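/- For every v-admissible triplet (4,c,n): A(4,c,n) = 1 if c is even, and A(4,c,n) = 5/4 if c is odd. -/

import Mathlib

open SimpleGraph Set

/-- Auxiliary distance on representations of points of the metric graph:
a point is represented by `(u, v, t)` with `u, v` adjacent and `t ∈ [0,1]`,
meaning the point on the edge `[u,v]` at distance `t` from `u`. -/
noncomputable def mgDistAux {V : Type} [Fintype V] [DecidableEq V] (G : SimpleGraph V)
    (p q : V × V × ℝ) : ℝ :=
  min
    (min (if p.1 = q.1 ∧ p.2.1 = q.2.1 then |p.2.2 - q.2.2| else (Fintype.card V : ℝ) + 1)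
         (if p.1 = q.2.1 ∧ p.2.1 = q.1 then |p.2.2 - (1 - q.2.2)| else (Fintype.card V : ℝ) + 1))
    (min (min (p.2.2 + (G.dist p.1 q.1 : ℝ) + q.2.2)
              (p.2.2 + (G.dist p.1 q.2.1 : ℝ) + (1 - q.2.2)))
         (min ((1 - p.2.2) + (G.dist p.2.1 q.1 : ℝ) + q.2.2)
              ((1 - p.2.2) + (G.dist p.2.1 q.2.1 : ℝ) + (1 - q.2.2))))

/-- The points of the metric graph associated to a simple graph `G`:
the vertices together with the interior points of the edges. -/
def MGPoint {V : Type} (G : SimpleGraph V) : Type :=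
  {p : V × V × ℝ // G.Adj p.1 p.2.1 ∧ p.2.2 ∈ Set.Icc (0 : ℝ) 1}

/-- The shortest-path distance on the metric graph associated to `G`
(every edge has length 1). -/
noncomputable def mgDist {V : Type} [Fintype V] [DecidableEq V] (G : SimpleGraph V)
    (p q : MGPoint G) : ℝ := mgDistAux G p.1 q.1

/-- Distance from a vertex `v` to a point of the metric graph. -/
noncomputable def mgVDist {V : Type} [Fintype V] [DecidableEq V] (G : SimpleGraph V)
    (v : V) (x : MGPoint G) : ℝ :=
  min ((G.dist v x.1.1 : ℝ) + x.1.2.2) ((G.dist v x.1.2.1 : ℝ) + (1 - x.1.2.2))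

/-- `γ` restricted to `[a,b]` is a geodesic in the metric graph of `G`
(an arc-length parametrization realizing distances). -/
def IsMGGeodesic {V : Type} [Fintype V] [DecidableEq V] (G : SimpleGraph V)
    (a b : ℝ) (γ : ℝ → MGPoint G) : Prop :=
  a ≤ b ∧ ∀ s ∈ Set.Icc a b, ∀ t ∈ Set.Icc a b, mgDist G (γ s) (γ t) = |s - t|

/-- A geodesic triangle in the metric graph of `G`: three geodesic sides whose
endpoints match cyclically (distance `0` means equality of points). -/
structure MGTriangle {V : Type} [Fintype V] [DecidableEq V] (G : SimpleGraph V) where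
  a1 : ℝ
  b1 : ℝ
  a2 : ℝ
  b2 : ℝ
  a3 : ℝ
  b3 : ℝ
  g1 : ℝ → MGPoint G
  g2 : ℝ → MGPoint G
  g3 : ℝ → MGPoint G
  h1 : IsMGGeodesic G a1 b1 g1
  h2 : IsMGGeodesic G a2 b2 g2
  h3 : IsMGGeodesic G a3 b3 g3
  glue1 : mgDist G (g1 b1) (g2 a2) = 0
  glue2 : mgDist G (g2 b2) (g3 a3) = 0
  glue3 : mgDist G (g3 b3) (g1 a1) = 0

/-- The sharp thin constant `δ(T)` of a geodesic triangle: the infimum of the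
`d ≥ 0` such that each side is contained in the `d`-neighborhood of the union of
the other two sides. -/
noncomputable def triangleDelta {V : Type} [Fintype V] [DecidableEq V] {G : SimpleGraph V}
    (T : MGTriangle G) : ℝ :=
  sInf {d : ℝ | 0 ≤ d ∧
    (∀ s ∈ Set.Icc T.a1 T.b1,
      (∃ t ∈ Set.Icc T.a2 T.b2, mgDist G (T.g1 s) (T.g2 t) ≤ d) ∨
      (∃ t ∈ Set.Icc T.a3 T.b3, mgDist G (T.g1 s) (T.g3 t) ≤ d)) ∧
    (∀ s ∈ Set.Icc T.a2 T.b2,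
      (∃ t ∈ Set.Icc T.a1 T.b1, mgDist G (T.g2 s) (T.g1 t) ≤ d) ∨
      (∃ t ∈ Set.Icc T.a3 T.b3, mgDist G (T.g2 s) (T.g3 t) ≤ d)) ∧
    (∀ s ∈ Set.Icc T.a3 T.b3,
      (∃ t ∈ Set.Icc T.a1 T.b1, mgDist G (T.g3 s) (T.g1 t) ≤ d) ∨
      (∃ t ∈ Set.Icc T.a2 T.b2, mgDist G (T.g3 s) (T.g2 t) ≤ d))}

/-- The hyperbolicity constant `δ(G)`: the supremum of `δ(T)` over all geodesic
triangles `T` in the metric graph of `G`. -/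
noncomputable def hypDelta {V : Type} [Fintype V] [DecidableEq V] (G : SimpleGraph V) : ℝ :=
  sSup {d : ℝ | ∃ T : MGTriangle G, d = triangleDelta T}

/-- The circumference of `G`: the length of a longest cycle. -/
noncomputable def circumference {V : Type} (G : SimpleGraph V) : ℕ :=
  sSup {n : ℕ | ∃ (a : V) (w : G.Walk a a), w.IsCycle ∧ w.length = n}

/-- `G` belongs to the class `𝒢(g,c,n)` of (connected) graphs with girth `g`,
circumference `c` and `n` vertices (vertex set `Fin n`). -/
def memGclass (g c : ℕ) {n : ℕ} (G : SimpleGraph (Fin n)) : Prop :=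
  G.Connected ∧ G.girth = g ∧ circumference G = c

/-- `A(g,c,n) = min {δ(G) : G ∈ 𝒢(g,c,n)}`. -/
noncomputable def Agcn (g c n : ℕ) : ℝ :=
  sInf {d : ℝ | ∃ G : SimpleGraph (Fin n), memGclass g c G ∧ d = hypDelta G}

/-- `B(g,c,n) = max {δ(G) : G ∈ 𝒢(g,c,n)}`. -/
noncomputable def Bgcn (g c n : ℕ) : ℝ :=
  sSup {d : ℝ | ∃ G : SimpleGraph (Fin n), memGclass g c G ∧ d = hypDelta G}

/-- `G` belongs to the class `ℋ(g,c,m)` of (connected) graphs with girth `g`,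
circumference `c` and `m` edges. -/
def memHclass (g c m : ℕ) {k : ℕ} (G : SimpleGraph (Fin k)) : Prop :=
  G.Connected ∧ G.girth = g ∧ circumference G = c ∧ G.edgeSet.ncard = m

/-- `α(g,c,m) = min {δ(G) : G ∈ ℋ(g,c,m)}`. -/
noncomputable def alphagcm (g c m : ℕ) : ℝ :=
  sInf {d : ℝ | ∃ (k : ℕ) (G : SimpleGraph (Fin k)), memHclass g c m G ∧ d = hypDelta G}

/-- `β(g,c,m) = max {δ(G) : G ∈ ℋ(g,c,m)}`. -/
noncomputable def betagcm (g c m : ℕ) : ℝ :=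
  sSup {d : ℝ | ∃ (k : ℕ) (G : SimpleGraph (Fin k)), memHclass g c m G ∧ d = hypDelta G}

section metric

set_option linter.unusedSectionVars false

variable {V : Type} [Fintype V] [DecidableEq V] {G : SimpleGraph V}

lemma dist_le_card (hG : G.Connected) (u v : V) : (G.dist u v : ℝ) ≤ Fintype.card V := by
  obtain ⟨p, hp, hl⟩ := hG.exists_path_of_dist u v
  have := hp.length_lt
  exact_mod_cast (by omega : G.dist u v ≤ Fintype.card V)

/-- the distance is at most each of the four routes through vertices -/
lemma mgDist_le_four (p q : MGPoint G) :
    mgDist G p q ≤ p.1.2.2 + (G.dist p.1.1 q.1.1 : ℝ) + q.1.2.2 ∧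
    mgDist G p q ≤ p.1.2.2 + (G.dist p.1.1 q.1.2.1 : ℝ) + (1 - q.1.2.2) ∧
    mgDist G p q ≤ (1 - p.1.2.2) + (G.dist p.1.2.1 q.1.1 : ℝ) + q.1.2.2 ∧
    mgDist G p q ≤ (1 - p.1.2.2) + (G.dist p.1.2.1 q.1.2.1 : ℝ) + (1 - q.1.2.2) := by
  unfold mgDist mgDistAux
  refine ⟨?_, ?_, ?_, ?_⟩ <;> simp

lemma mgDist_cases (hG : G.Connected) (p q : MGPoint G) :
    (p.1.1 = q.1.1 ∧ p.1.2.1 = q.1.2.1 ∧ mgDist G p q = |p.1.2.2 - q.1.2.2|) ∨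
    (p.1.1 = q.1.2.1 ∧ p.1.2.1 = q.1.1 ∧ mgDist G p q = |p.1.2.2 - (1 - q.1.2.2)|) ∨
    mgDist G p q = p.1.2.2 + (G.dist p.1.1 q.1.1 : ℝ) + q.1.2.2 ∨
    mgDist G p q = p.1.2.2 + (G.dist p.1.1 q.1.2.1 : ℝ) + (1 - q.1.2.2) ∨
    mgDist G p q = (1 - p.1.2.2) + (G.dist p.1.2.1 q.1.1 : ℝ) + q.1.2.2 ∨
    mgDist G p q = (1 - p.1.2.2) + (G.dist p.1.2.1 q.1.2.1 : ℝ) + (1 - q.1.2.2) := by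
  have hfour := mgDist_le_four p q
  have h1 := dist_le_card hG p.1.1 q.1.1
  have h2 := dist_le_card hG p.1.2.1 q.1.2.1
  have hlt : mgDist G p q < (Fintype.card V : ℝ) + 1 ∨
      mgDist G p q = p.1.2.2 + (G.dist p.1.1 q.1.1 : ℝ) + q.1.2.2 := by
    by_contra hcon
    push Not at hcon
    obtain ⟨hc1, hc2⟩ := hcon
    have := lt_of_le_of_ne hfour.1 hc2
    linarith [hfour.2.2.2]
  rcases hlt with hlt | hlt
  swap
  · tauto
  have key : mgDist G p q = mgDistAux G p.1 q.1 := rfl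
  rw [key] at hlt ⊢
  unfold mgDistAux at hlt ⊢
  set C : ℝ := (Fintype.card V : ℝ) + 1
  rcases min_choice (min (if p.1.1 = q.1.1 ∧ p.1.2.1 = q.1.2.1 then |p.1.2.2 - q.1.2.2| else C)
         (if p.1.1 = q.1.2.1 ∧ p.1.2.1 = q.1.1 then |p.1.2.2 - (1 - q.1.2.2)| else C))
    (min (min (p.1.2.2 + (G.dist p.1.1 q.1.1 : ℝ) + q.1.2.2)
              (p.1.2.2 + (G.dist p.1.1 q.1.2.1 : ℝ) + (1 - q.1.2.2)))
         (min ((1 - p.1.2.2) + (G.dist p.1.2.1 q.1.1 : ℝ) + q.1.2.2)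
              ((1 - p.1.2.2) + (G.dist p.1.2.1 q.1.2.1 : ℝ) + (1 - q.1.2.2)))) with h | h <;>
    rw [h] at hlt ⊢ <;> clear h
  · rcases min_choice (if p.1.1 = q.1.1 ∧ p.1.2.1 = q.1.2.1 then |p.1.2.2 - q.1.2.2| else C)
         (if p.1.1 = q.1.2.1 ∧ p.1.2.1 = q.1.1 then |p.1.2.2 - (1 - q.1.2.2)| else C)
         with h | h <;> rw [h] at hlt ⊢ <;> clear h
    · by_cases hc : p.1.1 = q.1.1 ∧ p.1.2.1 = q.1.2.1
      · rw [if_pos hc]; left; exact ⟨hc.1, hc.2, rfl⟩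
      · rw [if_neg hc] at hlt; exact absurd hlt (lt_irrefl _)
    · by_cases hc : p.1.1 = q.1.2.1 ∧ p.1.2.1 = q.1.1
      · rw [if_pos hc]; right; left; exact ⟨hc.1, hc.2, rfl⟩
      · rw [if_neg hc] at hlt; exact absurd hlt (lt_irrefl _)
  · right; right
    rcases min_choice (min (p.1.2.2 + (G.dist p.1.1 q.1.1 : ℝ) + q.1.2.2)
              (p.1.2.2 + (G.dist p.1.1 q.1.2.1 : ℝ) + (1 - q.1.2.2)))
         (min ((1 - p.1.2.2) + (G.dist p.1.2.1 q.1.1 : ℝ) + q.1.2.2)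
              ((1 - p.1.2.2) + (G.dist p.1.2.1 q.1.2.1 : ℝ) + (1 - q.1.2.2)))
      with h | h <;> rw [h] at hlt ⊢ <;> clear h
    · rcases min_choice (p.1.2.2 + (G.dist p.1.1 q.1.1 : ℝ) + q.1.2.2)
              (p.1.2.2 + (G.dist p.1.1 q.1.2.1 : ℝ) + (1 - q.1.2.2)) with h | h <;>
        rw [h] <;> simp
    · rcases min_choice ((1 - p.1.2.2) + (G.dist p.1.2.1 q.1.1 : ℝ) + q.1.2.2)
              ((1 - p.1.2.2) + (G.dist p.1.2.1 q.1.2.1 : ℝ) + (1 - q.1.2.2)) with h | h <;>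
        rw [h] <;> simp

lemma mgDist_le_same (p q : MGPoint G) (h1 : p.1.1 = q.1.1) (h2 : p.1.2.1 = q.1.2.1) :
    mgDist G p q ≤ |p.1.2.2 - q.1.2.2| := by
  unfold mgDist mgDistAux
  rw [if_pos ⟨h1, h2⟩]
  exact (min_le_left _ _).trans (min_le_left _ _)

lemma mgDist_le_swap (p q : MGPoint G) (h1 : p.1.1 = q.1.2.1) (h2 : p.1.2.1 = q.1.1) :
    mgDist G p q ≤ |p.1.2.2 - (1 - q.1.2.2)| := by
  unfold mgDist mgDistAux
  rw [if_pos (show p.1.1 = q.1.2.1 ∧ p.1.2.1 = q.1.1 from ⟨h1, h2⟩)]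
  exact (min_le_left _ _).trans (min_le_right _ _)

/-- the point represents the vertex `w` -/
def IsVertexAt (p : MGPoint G) (w : V) : Prop :=
  (p.1.1 = w ∧ p.1.2.2 = 0) ∨ (p.1.2.1 = w ∧ p.1.2.2 = 1)

lemma mgDist_vertex_le (z p : MGPoint G) (w : V) (hp : IsVertexAt p w) :
    mgDist G z p ≤ z.1.2.2 + G.dist z.1.1 w ∧ mgDist G z p ≤ 1 - z.1.2.2 + G.dist z.1.2.1 w := by
  obtain ⟨h1, h2, h3, h4⟩ := mgDist_le_four z p
  rcases hp with ⟨rfl, h⟩ | ⟨rfl, h⟩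
  · rw [h] at h1 h3; constructor <;> linarith
  · rw [h] at h2 h4; constructor <;> linarith

lemma dist_of_adj {u v : V} (h : G.Adj u v) : (G.dist u v : ℝ) = 1 := by
  have := SimpleGraph.dist_eq_one_iff_adj.mpr h
  exact_mod_cast this

lemma mgDist_vertex_ge (hG : G.Connected) (z p : MGPoint G) (w : V) (hp : IsVertexAt p w) :
    z.1.2.2 + G.dist z.1.1 w ≤ mgDist G z p ∨ 1 - z.1.2.2 + G.dist z.1.2.1 w ≤ mgDist G z p := by
  have hz0 := z.2.2.1
  have hz1 := z.2.2.2
  have ha : ((G.dist p.1.1 p.1.2.1 : ℕ) : ℝ) = 1 := dist_of_adj p.2.1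
  have ha' : ((G.dist p.1.2.1 p.1.1 : ℕ) : ℝ) = 1 := dist_of_adj p.2.1.symm
  have t1 : (G.dist z.1.1 p.1.1 : ℝ) ≤ G.dist z.1.1 p.1.2.1 + G.dist p.1.2.1 p.1.1 := by
    exact_mod_cast hG.dist_triangle
  have t2 : (G.dist z.1.1 p.1.2.1 : ℝ) ≤ G.dist z.1.1 p.1.1 + G.dist p.1.1 p.1.2.1 := by
    exact_mod_cast hG.dist_triangle
  have t3 : (G.dist z.1.2.1 p.1.1 : ℝ) ≤ G.dist z.1.2.1 p.1.2.1 + G.dist p.1.2.1 p.1.1 := by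
    exact_mod_cast hG.dist_triangle
  have t4 : (G.dist z.1.2.1 p.1.2.1 : ℝ) ≤ G.dist z.1.2.1 p.1.1 + G.dist p.1.1 p.1.2.1 := by
    exact_mod_cast hG.dist_triangle
  have s1 : (G.dist p.1.1 p.1.1 : ℝ) = 0 := by simp
  have s2 : (G.dist p.1.2.1 p.1.2.1 : ℝ) = 0 := by simp
  rcases hp with ⟨rfl, h⟩ | ⟨rfl, h⟩ <;>
  rcases mgDist_cases hG z p with ⟨e1, e2, e⟩ | ⟨e1, e2, e⟩ | e | e | e | e <;> rw [e]
  · left; rw [e1, h, s1]; linarith [le_abs_self (z.1.2.2 - 0)]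
  · right; rw [e2, h, s1]; linarith [neg_le_abs (z.1.2.2 - (1 - 0))]
  · left; linarith
  · left; linarith
  · right; linarith
  · right; linarith
  · right; rw [e2, h, s2]; linarith [neg_le_abs (z.1.2.2 - 1)]
  · left; rw [e1, h, s2]; linarith [le_abs_self (z.1.2.2 - (1 - 1))]
  · left; linarith
  · left; linarith
  · right; linarith
  · right; linarith

lemma mgDist_congr_vertex (hG : G.Connected) (z p q : MGPoint G) (w : V) (hp : IsVertexAt p w)
    (hq : IsVertexAt q w) : mgDist G z p = mgDist G z q := by
  have a := mgDist_vertex_le z p w hp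
  have b := mgDist_vertex_le z q w hq
  rcases mgDist_vertex_ge hG z p w hp with c | c <;>
  rcases mgDist_vertex_ge hG z q w hq with d | d <;> linarith

lemma mgDist_swap_le (z p q : MGPoint G) (h1 : p.1.1 = q.1.2.1) (h2 : p.1.2.1 = q.1.1)
    (h : p.1.2.2 = 1 - q.1.2.2) (hG : G.Connected) : mgDist G z p ≤ mgDist G z q := by
  obtain ⟨f1, f2, f3, f4⟩ := mgDist_le_four z p
  rw [h1, h] at f1; rw [h2, h] at f2; rw [h1, h] at f3; rw [h2, h] at f4
  rcases mgDist_cases hG z q with ⟨e1, e2, e⟩ | ⟨e1, e2, e⟩ | e | e | e | e <;> rw [e]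
  · have := mgDist_le_swap z p (by rw [e1, h2]) (by rw [e2, h1])
    rwa [h, sub_sub_cancel] at this
  · have := mgDist_le_same z p (by rw [e1, h1]) (by rw [e2, h2])
    rwa [h] at this
  all_goals linarith

lemma mgDist_congr (hG : G.Connected) (z p q : MGPoint G) (h : mgDist G p q = 0) :
    mgDist G z p = mgDist G z q := by
  have hp0 : 0 ≤ p.1.2.2 := p.2.2.1
  have hp1 : p.1.2.2 ≤ 1 := p.2.2.2
  have hq0 : 0 ≤ q.1.2.2 := q.2.2.1
  have hq1 : q.1.2.2 ≤ 1 := q.2.2.2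
  have hd : ∀ u v : V, (G.dist u v : ℝ) ≤ 0 → u = v := by
    intro u v h
    have h' : G.dist u v ≤ 0 := by exact_mod_cast h
    exact hG.dist_eq_zero_iff.mp (by omega)
  have hn : ∀ u v : V, (0:ℝ) ≤ (G.dist u v : ℝ) := fun u v => by positivity
  rcases mgDist_cases hG p q with ⟨e1, e2, e⟩ | ⟨e1, e2, e⟩ | e | e | e | e <;> rw [e] at h
  · have : p = q := by
      apply Subtype.ext
      refine Prod.ext e1 (Prod.ext e2 ?_)
      have := abs_eq_zero.mp h
      linarith
    rw [this]
  · have h' := abs_eq_zero.mp h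
    exact le_antisymm (mgDist_swap_le z p q e1 e2 (by linarith) hG)
      (mgDist_swap_le z q p e2.symm e1.symm (by linarith) hG)
  · have := hn p.1.1 q.1.1
    exact mgDist_congr_vertex hG z p q q.1.1
      (Or.inl ⟨hd _ _ (by linarith), by linarith⟩) (Or.inl ⟨rfl, by linarith⟩)
  · have := hn p.1.1 q.1.2.1
    exact mgDist_congr_vertex hG z p q q.1.2.1
      (Or.inl ⟨hd _ _ (by linarith), by linarith⟩) (Or.inr ⟨rfl, by linarith⟩)
  · have := hn p.1.2.1 q.1.1
    exact mgDist_congr_vertex hG z p q q.1.1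
      (Or.inr ⟨hd _ _ (by linarith), by linarith⟩) (Or.inl ⟨rfl, by linarith⟩)
  · have := hn p.1.2.1 q.1.2.1
    exact mgDist_congr_vertex hG z p q q.1.2.1
      (Or.inr ⟨hd _ _ (by linarith), by linarith⟩) (Or.inr ⟨rfl, by linarith⟩)

lemma side_near (hG : G.Connected) {M : ℝ} (hM : ∀ p q : MGPoint G, mgDist G p q ≤ 2 * M)
    {a b : ℝ} {γ : ℝ → MGPoint G} (h : IsMGGeodesic G a b γ) (x y : MGPoint G)
    (hx : ∀ z, mgDist G z x = mgDist G z (γ b)) (hy : ∀ z, mgDist G z y = mgDist G z (γ a))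
    (s : ℝ) (hs : s ∈ Set.Icc a b) : mgDist G (γ s) x ≤ M ∨ mgDist G (γ s) y ≤ M := by
  obtain ⟨hab, h⟩ := h
  have hl := h a ⟨le_rfl, hab⟩ b ⟨hab, le_rfl⟩
  have hb := h s hs b ⟨hab, le_rfl⟩
  have ha := h s hs a ⟨le_rfl, hab⟩
  have := hM (γ a) (γ b)
  rw [hx, hy, ha, hb]
  obtain ⟨h1, h2⟩ := hs
  rw [abs_of_nonpos (by linarith)] at hl
  rw [abs_of_nonpos (by linarith), abs_of_nonneg (by linarith : 0 ≤ s - a)]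
  by_contra hc
  push Not at hc
  linarith [hc.1, hc.2]

lemma triangleDelta_le (hG : G.Connected) {M : ℝ} (hM0 : 0 ≤ M)
    (hM : ∀ p q : MGPoint G, mgDist G p q ≤ 2 * M) (T : MGTriangle G) :
    triangleDelta T ≤ M := by
  unfold triangleDelta
  apply csInf_le ⟨0, fun d hd => hd.1⟩
  have c1 := fun z => mgDist_congr hG z _ _ T.glue1
  have c2 := fun z => mgDist_congr hG z _ _ T.glue2
  have c3 := fun z => mgDist_congr hG z _ _ T.glue3
  have n1 := T.h1.1
  have n2 := T.h2.1
  have n3 := T.h3.1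
  refine ⟨hM0, ?_, ?_, ?_⟩ <;> intro s hs
  · rcases side_near hG hM T.h1 (T.g2 T.a2) (T.g3 T.b3) (fun z => (c1 z).symm) c3 s hs with h | h
    · exact Or.inl ⟨_, ⟨le_rfl, n2⟩, h⟩
    · exact Or.inr ⟨_, ⟨n3, le_rfl⟩, h⟩
  · rcases side_near hG hM T.h2 (T.g3 T.a3) (T.g1 T.b1) (fun z => (c2 z).symm) c1 s hs with h | h
    · exact Or.inr ⟨_, ⟨le_rfl, n3⟩, h⟩
    · exact Or.inl ⟨_, ⟨n1, le_rfl⟩, h⟩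
  · rcases side_near hG hM T.h3 (T.g1 T.a1) (T.g2 T.b2) (fun z => (c3 z).symm) c2 s hs with h | h
    · exact Or.inl ⟨_, ⟨le_rfl, n1⟩, h⟩
    · exact Or.inr ⟨_, ⟨n2, le_rfl⟩, h⟩

lemma hypDelta_le (hG : G.Connected) {M : ℝ} (hM0 : 0 ≤ M)
    (hM : ∀ p q : MGPoint G, mgDist G p q ≤ 2 * M) : hypDelta G ≤ M := by
  apply Real.sSup_le _ hM0
  rintro d ⟨T, rfl⟩
  exact triangleDelta_le hG hM0 hM T

lemma le_hypDelta (hG : G.Connected) (T : MGTriangle G) : triangleDelta T ≤ hypDelta G := by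
  refine le_csSup ?_ ⟨T, rfl⟩
  refine ⟨(Fintype.card V + 2 : ℝ), ?_⟩
  rintro d ⟨T, rfl⟩
  apply triangleDelta_le hG (by positivity)
  intro p q
  have h1 := (mgDist_le_four p q).1
  have h2 := dist_le_card hG p.1.1 q.1.1
  have hp1 : p.1.2.2 ≤ 1 := p.2.2.2
  have hq1 : q.1.2.2 ≤ 1 := q.2.2.2
  have : (0:ℝ) ≤ Fintype.card V := by positivity
  linarith

/-- diameter bound from opposite pairs -/
lemma mgDist_le_of_pairs {D : ℝ}
    (h : ∀ u v u' v' : V, G.Adj u v → G.Adj u' v' →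
      (G.dist u u' : ℝ) + G.dist v v' + 2 ≤ 2 * D ∨ (G.dist u v' : ℝ) + G.dist v u' + 2 ≤ 2 * D)
    (p q : MGPoint G) : mgDist G p q ≤ D := by
  obtain ⟨f1, f2, f3, f4⟩ := mgDist_le_four p q
  rcases h _ _ _ _ p.2.1 q.2.1 with h | h <;> linarith

/-! ### isometric cycles -/

/-- point at arc-length `s` of a bi-infinite walk -/
noncomputable def arcPt (v : ℤ → V) (hv : ∀ i, G.Adj (v i) (v (i + 1))) (s : ℝ) : MGPoint G :=
  ⟨(v ⌊s⌋, v (⌊s⌋ + 1), Int.fract s), hv _, Int.fract_nonneg s, (Int.fract_lt_one s).le⟩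

lemma walk_along (v : ℤ → V) (hv : ∀ i, G.Adj (v i) (v (i + 1))) (i : ℤ) (m : ℕ) :
    ∃ p : G.Walk (v i) (v (i + m)), p.length = m := by
  induction m with
  | zero => exact ⟨Walk.nil.copy rfl (by simp), by simp⟩
  | succ k ih =>
    obtain ⟨p, hp⟩ := ih
    have := hv (i + k)
    exact ⟨(p.concat this).copy rfl (by push_cast; ring_nf), by simp [hp]⟩

lemma dist_along (v : ℤ → V) (hv : ∀ i, G.Adj (v i) (v (i + 1))) (i j : ℤ) :
    (G.dist (v i) (v j) : ℝ) ≤ |(i:ℝ) - j| := by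
  wlog hij : i ≤ j generalizing i j
  · rw [SimpleGraph.dist_comm, abs_sub_comm]
    exact this j i (by omega)
  obtain ⟨m, rfl⟩ := Int.le.dest hij
  obtain ⟨p, hp⟩ := walk_along v hv i m
  have : G.dist (v i) (v (i + m)) ≤ m := (SimpleGraph.dist_le p).trans hp.le
  have h2 : (G.dist (v i) (v (i + m)) : ℝ) ≤ m := by exact_mod_cast this
  push_cast
  rw [abs_sub_comm, add_sub_cancel_left]
  exact h2.trans (le_abs_self _)

lemma arc_le (v : ℤ → V) (hv : ∀ i, G.Adj (v i) (v (i + 1))) (s t : ℝ) :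
    mgDist G (arcPt v hv s) (arcPt v hv t) ≤ |s - t| := by
  have es := Int.floor_add_fract s
  have et := Int.floor_add_fract t
  rcases lt_trichotomy ⌊s⌋ ⌊t⌋ with h | h | h
  · have h3 := (mgDist_le_four (arcPt v hv s) (arcPt v hv t)).2.2.1
    have hd := dist_along v hv (⌊s⌋ + 1) ⌊t⌋
    have hc : (⌊s⌋ : ℝ) + 1 ≤ ⌊t⌋ := by exact_mod_cast h
    push_cast at hd
    rw [abs_of_nonpos (by linarith)] at hd
    simp only [arcPt] at h3 ⊢
    linarith [neg_le_abs (s - t)]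
  · have := mgDist_le_same (arcPt v hv s) (arcPt v hv t) (by simp [arcPt, h]) (by simp [arcPt, h])
    refine this.trans (le_of_eq ?_)
    have hc : (⌊s⌋ : ℝ) = ⌊t⌋ := by exact_mod_cast h
    simp only [arcPt]
    congr 1
    linarith
  · have h3 := (mgDist_le_four (arcPt v hv s) (arcPt v hv t)).2.1
    have hd := dist_along v hv ⌊s⌋ (⌊t⌋ + 1)
    have hc : (⌊t⌋ : ℝ) + 1 ≤ ⌊s⌋ := by exact_mod_cast h
    push_cast at hd
    rw [abs_of_nonneg (by linarith)] at hd
    simp only [arcPt] at h3 ⊢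
    linarith [le_abs_self (s - t)]

lemma arc_ge (hG : G.Connected) (v : ℤ → V) (hv : ∀ i, G.Adj (v i) (v (i + 1))) (L : ℕ)
    (hL : 3 ≤ L)
    (H : ∀ i j : ℤ, ∃ k : ℤ, |i - j - k * L| ≤ (G.dist (v i) (v j) : ℤ)) (s t : ℝ) :
    ∃ k : ℤ, |s - t - k * L| ≤ mgDist G (arcPt v hv s) (arcPt v hv t) := by
  have es := Int.floor_add_fract s
  have et := Int.floor_add_fract t
  have s0 := Int.fract_nonneg s
  have s1 := Int.fract_lt_one s
  have t0 := Int.fract_nonneg t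
  have t1 := Int.fract_lt_one t
  have H' : ∀ i j : ℤ, ∃ k : ℤ, |(i:ℝ) - j - k * L| ≤ (G.dist (v i) (v j) : ℝ) := by
    intro i j
    obtain ⟨k, hk⟩ := H i j
    exact ⟨k, by exact_mod_cast hk⟩
  have H0 : ∀ i j : ℤ, v i = v j → ∃ k : ℤ, i - j = k * L := by
    intro i j hij
    obtain ⟨k, hk⟩ := H i j
    rw [hij] at hk
    simp only [SimpleGraph.dist_self, Nat.cast_zero] at hk
    exact ⟨k, by linarith [abs_eq_zero.mp (le_antisymm hk (abs_nonneg _))]⟩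
  rcases mgDist_cases hG (arcPt v hv s) (arcPt v hv t) with
    ⟨e1, e2, e⟩ | ⟨e1, e2, e⟩ | e | e | e | e <;> rw [e] <;> simp only [arcPt] at *
  · obtain ⟨k, hk⟩ := H0 _ _ e1
    refine ⟨k, le_of_eq ?_⟩
    have : (⌊s⌋ : ℝ) - ⌊t⌋ = k * L := by exact_mod_cast hk
    congr 1
    linarith
  · obtain ⟨k, hk⟩ := H0 _ _ e1
    obtain ⟨k', hk'⟩ := H0 _ _ e2
    exfalso
    have : (k' - k) * (L : ℤ) = 2 := by linarith
    have hd : (L : ℤ) ∣ 2 := Dvd.intro_left _ this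
    have := Int.le_of_dvd (by norm_num) hd
    omega
  · obtain ⟨k, hk⟩ := H' ⌊s⌋ ⌊t⌋
    refine ⟨k, ?_⟩
    rw [abs_le] at hk ⊢
    constructor <;> linarith
  · obtain ⟨k, hk⟩ := H' ⌊s⌋ (⌊t⌋ + 1)
    refine ⟨k, ?_⟩
    push_cast at hk
    rw [abs_le] at hk ⊢
    constructor <;> linarith
  · obtain ⟨k, hk⟩ := H' (⌊s⌋ + 1) ⌊t⌋
    refine ⟨k, ?_⟩
    push_cast at hk
    rw [abs_le] at hk ⊢
    constructor <;> linarith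
  · obtain ⟨k, hk⟩ := H' (⌊s⌋ + 1) (⌊t⌋ + 1)
    refine ⟨k, ?_⟩
    push_cast at hk
    rw [abs_le] at hk ⊢
    constructor <;> linarith

lemma circ_bound (x L : ℝ) (hL : 0 < L) (k : ℤ) (D : ℝ) (h : |x - k * L| ≤ D) :
    x ≤ D ∨ L - x ≤ D := by
  rw [abs_le] at h
  rcases le_or_gt k 0 with hk | hk
  · left
    have : (k : ℝ) ≤ 0 := by exact_mod_cast hk
    nlinarith
  · right
    have : (1 : ℝ) ≤ k := by exact_mod_cast hk
    nlinarith

lemma arc_ge' (hG : G.Connected) (v : ℤ → V) (hv : ∀ i, G.Adj (v i) (v (i + 1))) (L : ℕ)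
    (hL : 3 ≤ L)
    (H : ∀ i j : ℤ, ∃ k : ℤ, |i - j - k * L| ≤ (G.dist (v i) (v j) : ℤ)) (s t : ℝ) :
    |s - t| ≤ mgDist G (arcPt v hv s) (arcPt v hv t) ∨
    L - |s - t| ≤ mgDist G (arcPt v hv s) (arcPt v hv t) := by
  obtain ⟨k, hk⟩ := arc_ge hG v hv L hL H s t
  have hL' : (0:ℝ) < L := by exact_mod_cast (by omega : 0 < L)
  rcases abs_cases (s - t) with ⟨h, -⟩ | ⟨h, -⟩ <;> rw [h]
  · exact circ_bound _ _ hL' k _ hk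
  · refine circ_bound _ _ hL' (-k) _ ?_
    rw [← abs_neg] at hk
    convert hk using 2
    push_cast; ring

lemma arc_geod (hG : G.Connected) (v : ℤ → V) (hv : ∀ i, G.Adj (v i) (v (i + 1))) (L : ℕ)
    (hL : 3 ≤ L)
    (H : ∀ i j : ℤ, ∃ k : ℤ, |i - j - k * L| ≤ (G.dist (v i) (v j) : ℤ)) (a b : ℝ)
    (hab : a ≤ b) (hb : b - a ≤ L / 2) : IsMGGeodesic G a b (arcPt v hv) := by
  refine ⟨hab, fun s hs t ht => le_antisymm (arc_le v hv s t) ?_⟩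
  have : |s - t| ≤ L / 2 := by
    rw [abs_le]; constructor <;> linarith [hs.1, hs.2, ht.1, ht.2]
  rcases arc_ge' hG v hv L hL H s t with h | h
  · exact h
  · linarith

lemma arc_periodic (v : ℤ → V) (hv : ∀ i, G.Adj (v i) (v (i + 1))) (L : ℕ)
    (hper : ∀ i, v (i + L) = v i) (s : ℝ) : arcPt v hv (s + L) = arcPt v hv s := by
  apply Subtype.ext
  simp only [arcPt]
  have h1 : ⌊s + (L:ℝ)⌋ = ⌊s⌋ + L := Int.floor_add_natCast s L
  have h2 : Int.fract (s + (L:ℝ)) = Int.fract s := Int.fract_add_natCast s L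
  rw [h1, h2, hper, add_right_comm, hper]

theorem le_hypDelta_of_cycle (hG : G.Connected) (v : ℤ → V)
    (hv : ∀ i, G.Adj (v i) (v (i + 1))) (L : ℕ) (hL : 3 ≤ L) (hper : ∀ i, v (i + L) = v i)
    (H : ∀ i j : ℤ, ∃ k : ℤ, |i - j - k * L| ≤ (G.dist (v i) (v j) : ℤ)) :
    (L : ℝ) / 4 ≤ hypDelta G := by
  have hL' : (0:ℝ) < L := by exact_mod_cast (by omega : 0 < L)
  have self : ∀ s, mgDist G (arcPt v hv s) (arcPt v hv s) = 0 := by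
    intro s
    have := (arc_geod hG v hv L hL H s s le_rfl (by simp; positivity)).2 s ⟨le_rfl, le_rfl⟩ s
      ⟨le_rfl, le_rfl⟩
    simpa using this
  have hper0 : arcPt v hv L = arcPt v hv 0 := by
    have := arc_periodic v hv L hper 0
    rwa [zero_add] at this
  let T : MGTriangle G :=
    { a1 := 0, b1 := L / 2, a2 := L / 2, b2 := L, a3 := 0, b3 := 0
      g1 := arcPt v hv, g2 := arcPt v hv, g3 := arcPt v hv
      h1 := arc_geod hG v hv L hL H _ _ (by positivity) (by linarith)
      h2 := arc_geod hG v hv L hL H _ _ (by linarith) (by linarith)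
      h3 := arc_geod hG v hv L hL H _ _ le_rfl (by simp; positivity)
      glue1 := self _
      glue2 := by rw [hper0]; exact self _
      glue3 := self _ }
  refine le_trans ?_ (le_hypDelta hG T)
  unfold triangleDelta
  apply le_csInf
  · refine ⟨(Fintype.card V + 2 : ℝ), by positivity, ?_⟩
    have hb : ∀ p q : MGPoint G, mgDist G p q ≤ (Fintype.card V + 2 : ℝ) := by
      intro p q
      have h1 := (mgDist_le_four p q).1
      have h2 := dist_le_card hG p.1.1 q.1.1
      have hp1 : p.1.2.2 ≤ 1 := p.2.2.2
      have hq1 : q.1.2.2 ≤ 1 := q.2.2.2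
      linarith
    exact ⟨fun s _ => Or.inl ⟨_, ⟨le_rfl, T.h2.1⟩, hb _ _⟩,
      fun s _ => Or.inl ⟨_, ⟨le_rfl, T.h1.1⟩, hb _ _⟩,
      fun s _ => Or.inl ⟨_, ⟨le_rfl, T.h1.1⟩, hb _ _⟩⟩
  · rintro d ⟨-, hd, -⟩
    have key : ∀ t : ℝ, t ∈ Set.Icc ((L:ℝ) / 2) L ∨ t = 0 →
        (L:ℝ) / 4 ≤ mgDist G (arcPt v hv (L / 4)) (arcPt v hv t) := by
      intro t ht
      have h1 : (L:ℝ)/4 ≤ |(L:ℝ)/4 - t| ∧ |(L:ℝ)/4 - t| ≤ L - L / 4 := by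
        rcases ht with ⟨h1, h2⟩ | h
        · rw [abs_of_nonpos (by linarith)]; constructor <;> linarith
        · rw [h, sub_zero, abs_of_nonneg (by positivity)]; constructor <;> linarith
      rcases arc_ge' hG v hv L hL H (L / 4) t with h | h <;> linarith [h1.1, h1.2]
    rcases hd (L / 4) ⟨by positivity, show (L:ℝ) / 4 ≤ L / 2 by linarith⟩ with
      ⟨t, ht, h⟩ | ⟨t, ht, h⟩
    · exact (key t (Or.inl ht)).trans h
    · exact (key t (Or.inr (le_antisymm ht.2 ht.1))).trans h

end metric

section combinatorics

set_option linter.unusedSectionVars false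

variable {V : Type} [Fintype V] [DecidableEq V] {G : SimpleGraph V}

/-- the bi-infinite periodic walk around a closed walk -/
noncomputable def loopSeq {a : V} (w : G.Walk a a) (i : ℤ) : V :=
  w.getVert (i % (w.length : ℤ)).toNat

lemma loopSeq_adj {a : V} (w : G.Walk a a) (hw : 0 < w.length) (i : ℤ) :
    G.Adj (loopSeq w i) (loopSeq w (i + 1)) := by
  unfold loopSeq
  have h0 := Int.emod_nonneg i (by omega : (w.length : ℤ) ≠ 0)
  have h1 := Int.emod_lt_of_pos i (by omega : (0:ℤ) < w.length)
  have hadj := w.adj_getVert_succ (i := (i % (w.length : ℤ)).toNat) (by omega)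
  have h2 : (i + 1) % (w.length : ℤ) = (i % w.length + 1) % w.length := by
    rw [Int.emod_add_emod]
  rw [h2]
  set r := i % (w.length : ℤ)
  rcases eq_or_lt_of_le (show r + 1 ≤ w.length by omega) with h | h
  · rw [h, Int.emod_self]
    have h3 : r.toNat + 1 = w.length := by omega
    rw [h3, Walk.getVert_length] at hadj
    simpa using hadj
  · rw [Int.emod_eq_of_lt (by omega) h]
    have h3 : (r + 1).toNat = r.toNat + 1 := by omega
    rwa [h3]

lemma loopSeq_per {a : V} (w : G.Walk a a) (i : ℤ) :
    loopSeq w (i + (w.length : ℕ)) = loopSeq w i := by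
  unfold loopSeq
  rw [Int.add_emod_right]

lemma per_mul (v : ℤ → V) (L : ℕ) (hper : ∀ i, v (i + L) = v i) (i k : ℤ) :
    v (i + k * L) = v i := by
  induction k using Int.induction_on with
  | zero => simp
  | succ k ih => rw [← ih, ← hper (i + k * L)]; congr 1; ring
  | pred k ih => rw [← ih, ← hper]; congr 1; ring

lemma exists_cycle_of_seq {L : ℕ} (hL : 3 ≤ L) (u : ℕ → V)
    (hinj : ∀ i < L, ∀ j < L, u i = u j → i = j)
    (hadj : ∀ i, i + 1 < L → G.Adj (u i) (u (i + 1))) (hlast : G.Adj (u (L - 1)) (u 0)) :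
    ∃ (a : V) (w : G.Walk a a), w.IsCycle ∧ w.length = L := by
  have hpath : ∀ m, m < L → ∃ p : G.Walk (u 0) (u m), p.IsPath ∧ p.length = m ∧
      ∀ x ∈ p.support, ∃ i ≤ m, x = u i := by
    intro m
    induction m with
    | zero =>
      intro _
      exact ⟨Walk.nil, by simp, by simp, by simp⟩
    | succ k ih =>
      intro hk
      obtain ⟨p, hp, hl, hs⟩ := ih (by omega)
      refine ⟨p.concat (hadj k hk), ?_, by simp [hl], ?_⟩
      · rw [Walk.concat_isPath_iff]
        refine ⟨hp, fun hm => ?_⟩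
        obtain ⟨i, hi, he⟩ := hs _ hm
        have := hinj _ hk _ (by omega) he
        omega
      · intro x hx
        rw [Walk.support_concat] at hx
        simp only [List.mem_append, List.mem_singleton] at hx
        rcases hx with hx | hx
        · obtain ⟨i, hi, he⟩ := hs _ hx
          exact ⟨i, by omega, he⟩
        · exact ⟨k + 1, le_rfl, hx⟩
  obtain ⟨p, hp, hl, -⟩ := hpath (L - 1) (by omega)
  refine ⟨_, Walk.cons hlast p, ?_, by simp [hl]; omega⟩
  rw [Walk.isCycle_iff_isPath_tail_and_le_length]
  exact ⟨by simpa using hp, by simp [hl]; omega⟩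

lemma cycle_of_triangle {a b c : V} (hab : G.Adj a b) (hbc : G.Adj b c) (hca : G.Adj c a) :
    ∃ (a : V) (w : G.Walk a a), w.IsCycle ∧ w.length = 3 := by
  refine ⟨a, Walk.cons hab (Walk.cons hbc (Walk.cons hca Walk.nil)), ?_, by simp⟩
  rw [Walk.isCycle_iff_isPath_tail_and_le_length]
  refine ⟨?_, by simp⟩
  simp [Walk.isPath_def, hbc.ne, hca.ne, hab.ne.symm]

lemma no_triangle (hg : G.girth = 4) {a b c : V} (hab : G.Adj a b) (hbc : G.Adj b c)
    (hca : G.Adj c a) : False := by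
  obtain ⟨a, w, hw, hl⟩ := cycle_of_triangle hab hbc hca
  have := girth_le_length hw
  omega

/-- reducing to residues -/
lemma exists_residue (L : ℕ) (hL : 0 < L) (i j : ℤ) :
    ∃ (r : ℕ) (k : ℤ), r < L ∧ j = i + r + k * L := by
  have h0 := Int.emod_nonneg (j - i) (by omega : (L : ℤ) ≠ 0)
  have h1 := Int.emod_lt_of_pos (j - i) (by omega : (0:ℤ) < L)
  refine ⟨((j - i) % L).toNat, (j - i) / L, by omega, ?_⟩
  rw [Int.toNat_of_nonneg h0]
  have := Int.emod_add_mul_ediv (j - i) L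
  linarith

lemma iso_of_arcs (v : ℤ → V) (L : ℕ) (hL : 0 < L) (hper : ∀ i, v (i + L) = v i)
    (h : ∀ (i : ℤ) (r : ℕ), r < L → r ≤ G.dist (v i) (v (i + r)) ∨
      L - r ≤ G.dist (v i) (v (i + r))) :
    ∀ i j : ℤ, ∃ k : ℤ, |i - j - k * L| ≤ (G.dist (v i) (v j) : ℤ) := by
  intro i j
  obtain ⟨r, k, hr, rfl⟩ := exists_residue L hL i j
  rw [per_mul v L hper]
  rcases h i r hr with h | h
  · refine ⟨-k, ?_⟩
    have : i - (i + r + k * L) - -k * L = -(r:ℤ) := by ring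
    rw [this, abs_neg, abs_of_nonneg (by omega)]
    exact_mod_cast h
  · refine ⟨-k - 1, ?_⟩
    have : i - (i + r + k * L) - (-k - 1) * L = (L:ℤ) - r := by ring
    rw [this, abs_of_nonneg (by omega)]
    omega

/-- the four-cycle -/
lemma exists_iso_four (hG : G.Connected) (hg : G.girth = 4) :
    ∃ v : ℤ → V, (∀ i, G.Adj (v i) (v (i + 1))) ∧ (∀ i, v (i + (4 : ℕ)) = v i) ∧
      (∀ i, v i ≠ v (i + 2)) ∧
      ∀ i j : ℤ, ∃ k : ℤ, |i - j - k * (4 : ℕ)| ≤ (G.dist (v i) (v j) : ℤ) := by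
  have hac : ¬ G.IsAcyclic := by
    rw [← girth_eq_zero]; omega
  obtain ⟨a, w, hw, hl⟩ := exists_girth_eq_length.mpr hac
  have hl4 : w.length = 4 := by omega
  have hadj := loopSeq_adj w (by omega)
  have hper := loopSeq_per w
  have hne : ∀ i, loopSeq w i ≠ loopSeq w (i + 2) := by
    intro i he
    unfold loopSeq at he
    rw [hl4] at he
    have := hw.getVert_injOn' (x₁ := (i % ((4:ℕ) : ℤ)).toNat)
      (x₂ := ((i + 2) % ((4:ℕ) : ℤ)).toNat)
      (by simp only [Set.mem_ofPred_eq, hl4]; omega) (by simp only [Set.mem_ofPred_eq, hl4]; omega) he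
    omega
  rw [hl4] at hper
  refine ⟨loopSeq w, hadj, hper, hne, ?_⟩
  apply iso_of_arcs _ _ (by norm_num) hper
  intro i r hr
  have hpos : ∀ x y : V, x ≠ y → 1 ≤ G.dist x y := fun x y hxy =>
    hG.pos_dist_of_ne hxy
  interval_cases r
  · left; simp
  · left; exact hpos _ _ (by simpa using (hadj i).ne)
  · left
    have h1 := hpos _ _ (hne i)
    push_cast
    by_contra hc
    have h2 : G.dist (loopSeq w i) (loopSeq w (i + 2)) = 1 := by omega
    rw [SimpleGraph.dist_eq_one_iff_adj] at h2
    have h3 := hadj (i + 1)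
    rw [add_assoc] at h3
    exact no_triangle hg (hadj i) h3 h2.symm
  · right
    have := hadj (i + 3)
    have h4 := hper i
    rw [add_assoc] at this
    norm_num at this h4
    rw [h4] at this
    exact hpos _ _ (by simpa using this.ne.symm)

/-- the shortest odd closed walk -/
lemma exists_iso_odd (hG : G.Connected) (hg : G.girth = 4)
    (hodd : ∃ (a : V) (w : G.Walk a a), Odd w.length) :
    ∃ (L : ℕ) (v : ℤ → V), 5 ≤ L ∧ (∀ i, G.Adj (v i) (v (i + 1))) ∧
      (∀ i, v (i + L) = v i) ∧
      ∀ i j : ℤ, ∃ k : ℤ, |i - j - k * L| ≤ (G.dist (v i) (v j) : ℤ) := by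
  classical
  have hex : ∃ L : ℕ, Odd L ∧ ∃ (a : V) (w : G.Walk a a), w.length = L := by
    obtain ⟨a, w, hw⟩ := hodd
    exact ⟨_, hw, a, w, rfl⟩
  obtain ⟨hL, a, w, hw⟩ := Nat.find_spec hex
  have hmin := fun m => Nat.find_min hex (m := m)
  set L := Nat.find hex
  have hLpos : 0 < L := hL.pos
  have hadj := loopSeq_adj w (by omega)
  have hper := loopSeq_per w
  rw [hw] at hper
  refine ⟨L, loopSeq w, ?_, hadj, hper, ?_⟩
  · by_contra hlt
    have hL13 : L = 1 ∨ L = 3 := by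
      obtain ⟨m, hm⟩ := hL
      omega
    rcases hL13 with h | h <;> rw [h] at hper
    · have h1 := hadj 0
      have h2 := hper 0
      simp only [Nat.cast_one] at h2
      rw [h2] at h1
      exact h1.ne rfl
    · have h1 := hadj 0
      have h2 := hadj 1
      have h3 := hadj 2
      have h4 := hper 0
      norm_num at h1 h2 h3 h4
      rw [h4] at h3
      exact no_triangle hg h1 h2 h3
  · apply iso_of_arcs _ _ hLpos hper
    intro i r hr
    by_contra hcon
    push Not at hcon
    obtain ⟨c1, c2⟩ := hcon
    obtain ⟨p, hp⟩ := walk_along _ hadj i r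
    obtain ⟨q, hq⟩ := walk_along _ hadj (i + r) (L - r)
    obtain ⟨d, hd⟩ := hG.exists_walk_length_eq_dist (loopSeq w i) (loopSeq w (i + r))
    have he : loopSeq w (i + r + ((L - r : ℕ) : ℤ)) = loopSeq w i := by
      rw [← hper i]; congr 1; push_cast [hr.le]; ring
    rcases Nat.even_or_odd (p.length + d.length) with hev | hod
    · refine hmin (d.length + q.length) (by omega) ⟨?_, _, d.append (q.copy rfl he), by simp⟩
      rw [Nat.odd_iff] at hL ⊢
      rw [Nat.even_iff] at hev
      omega
    · exact hmin (p.length + d.length) (by omega) ⟨hod, _, p.append d.reverse, by simp⟩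

lemma exists_cycle_of_circ {c : ℕ} (hc : 0 < c) (h : circumference G = c) :
    ∃ (a : V) (w : G.Walk a a), w.IsCycle ∧ w.length = c := by
  unfold circumference at h
  have hne : {n : ℕ | ∃ (a : V) (w : G.Walk a a), w.IsCycle ∧ w.length = n}.Nonempty := by
    rw [Set.nonempty_iff_ne_empty]
    intro he
    rw [he] at h
    simp at h
    omega
  have hbd : BddAbove {n : ℕ | ∃ (a : V) (w : G.Walk a a), w.IsCycle ∧ w.length = n} := by
    by_contra hb
    have := Nat.sSup_of_not_bddAbove hb
    omega
  have := Nat.sSup_mem hne hbd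
  rw [h] at this
  exact this

/-- bound on the length of cycles from an almost vertex cover -/
lemma cycle_length_le {a : V} {w : G.Walk a a} (hw : w.IsCycle) (S : Finset V)
    (E : Finset (Sym2 V))
    (h : ∀ x y, G.Adj x y → x ∈ S ∨ y ∈ S ∨ s(x, y) ∈ E) : w.length ≤ 2 * S.card + E.card := by
  classical
  have h3 := hw.three_le_length
  have hsub : Finset.range w.length ⊆
      ((Finset.range w.length).filter (fun i => w.getVert i ∈ S)) ∪
      (((Finset.range w.length).filter (fun i => w.getVert (i + 1) ∈ S)) ∪
      ((Finset.range w.length).filter (fun i => s(w.getVert i, w.getVert (i + 1)) ∈ E))) := by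
    intro i hi
    have hi' := Finset.mem_range.mp hi
    have := h _ _ (w.adj_getVert_succ hi')
    simp only [Finset.mem_union, Finset.mem_filter]
    tauto
  have c1 : ((Finset.range w.length).filter (fun i => w.getVert i ∈ S)).card ≤ S.card := by
    apply Finset.card_le_card_of_injOn (fun i => w.getVert i)
    · intro i hi
      simp only [Finset.coe_filter, Set.mem_ofPred_eq] at hi
      exact hi.2
    · intro i hi j hj hij
      simp only [Finset.coe_filter, Set.mem_ofPred_eq, Finset.mem_range] at hi hj
      exact hw.getVert_injOn' (by simp only [Set.mem_ofPred_eq]; omega)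
        (by simp only [Set.mem_ofPred_eq]; omega) hij
  have c2 : ((Finset.range w.length).filter (fun i => w.getVert (i + 1) ∈ S)).card ≤ S.card := by
    apply Finset.card_le_card_of_injOn (fun i => w.getVert (i + 1))
    · intro i hi
      simp only [Finset.coe_filter, Set.mem_ofPred_eq] at hi
      exact hi.2
    · intro i hi j hj hij
      simp only [Finset.coe_filter, Set.mem_ofPred_eq, Finset.mem_range] at hi hj
      have := hw.getVert_injOn (by simp only [Set.mem_ofPred_eq]; omega)
        (by simp only [Set.mem_ofPred_eq]; omega) hij
      omega
  have c3 : ((Finset.range w.length).filter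
      (fun i => s(w.getVert i, w.getVert (i + 1)) ∈ E)).card ≤ E.card := by
    apply Finset.card_le_card_of_injOn (fun i => s(w.getVert i, w.getVert (i + 1)))
    · intro i hi
      simp only [Finset.coe_filter, Set.mem_ofPred_eq] at hi
      exact hi.2
    · intro i hi j hj hij
      simp only [Finset.coe_filter, Set.mem_ofPred_eq, Finset.mem_range] at hi hj
      have inj1 : ∀ m < w.length, ∀ n < w.length, w.getVert m = w.getVert n → m = n :=
        fun m hm n hn e => hw.getVert_injOn' (by simp only [Set.mem_ofPred_eq]; omega)
          (by simp only [Set.mem_ofPred_eq]; omega) e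
      have inj2 : ∀ m < w.length, ∀ n < w.length, w.getVert (m+1) = w.getVert (n+1) → m = n := by
        intro m hm n hn e
        have := hw.getVert_injOn (by simp only [Set.mem_ofPred_eq]; omega)
          (by simp only [Set.mem_ofPred_eq]; omega) e
        omega
      rcases Sym2.eq_iff.mp hij with ⟨e, -⟩ | ⟨e1, e2⟩
      · exact inj1 _ hi.1 _ hj.1 e
      · exfalso
        have wrap : ∀ m < w.length, ∀ n < w.length, w.getVert m = w.getVert (n + 1) →
            m = n + 1 ∨ (m = 0 ∧ n + 1 = w.length) := by
          intro m hm n hn e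
          by_cases hn' : n + 1 < w.length
          · exact Or.inl (inj1 _ hm _ hn' e)
          · right
            have hn2 : n + 1 = w.length := by omega
            refine ⟨inj1 _ hm 0 (by omega) ?_, hn2⟩
            rw [e, hn2]; simp
        have := wrap _ hi.1 _ hj.1 e1
        have := wrap _ hj.1 _ hi.1 e2.symm
        omega
  have := Finset.card_le_card hsub
  rw [Finset.card_range] at this
  have u1 := Finset.card_union_le
    ((Finset.range w.length).filter (fun i => w.getVert i ∈ S))
    (((Finset.range w.length).filter (fun i => w.getVert (i + 1) ∈ S)) ∪
      ((Finset.range w.length).filter (fun i => s(w.getVert i, w.getVert (i + 1)) ∈ E)))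
  have u2 := Finset.card_union_le
    ((Finset.range w.length).filter (fun i => w.getVert (i + 1) ∈ S))
    ((Finset.range w.length).filter (fun i => s(w.getVert i, w.getVert (i + 1)) ∈ E))
  omega

lemma circ_eq {c : ℕ} (hex : ∃ (a : V) (w : G.Walk a a), w.IsCycle ∧ w.length = c)
    (hle : ∀ (a : V) (w : G.Walk a a), w.IsCycle → w.length ≤ c) : circumference G = c := by
  apply IsGreatest.csSup_eq
  refine ⟨hex, ?_⟩
  rintro n ⟨a, w, hw, rfl⟩
  exact hle a w hw

lemma girth_eq_four (hex : ∃ (a : V) (w : G.Walk a a), w.IsCycle ∧ w.length = 4)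
    (htri : ∀ a b c, G.Adj a b → G.Adj b c → G.Adj c a → False) : G.girth = 4 := by
  obtain ⟨a, w, hw, hl⟩ := hex
  have h1 := girth_le_length hw
  have hac : ¬ G.IsAcyclic := fun h => h w hw
  have h2 := three_le_girth hac
  obtain ⟨b, u, hu, hlu⟩ := exists_girth_eq_length.mpr hac
  by_contra hne
  have h3 : u.length = 3 := by omega
  have a0 := u.adj_getVert_succ (i := 0) (by omega)
  have a1 := u.adj_getVert_succ (i := 1) (by omega)
  have a2 := u.adj_getVert_succ (i := 2) (by omega)
  have e : u.getVert (2 + 1) = u.getVert 0 := by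
    have : 2 + 1 = u.length := by omega
    rw [this]; simp
  rw [e] at a2
  exact htri _ _ _ a0 a1 a2

end combinatorics

section constructions

lemma conn_of_two {V : Type} [Nonempty V] {G : SimpleGraph V}
    (h : ∀ x y : V, G.Adj x y ∨ ∃ z, G.Adj x z ∧ G.Adj z y) : G.Connected := by
  refine ⟨fun x y => ?_⟩
  rcases h x y with h | ⟨z, h1, h2⟩
  · exact h.reachable
  · exact h1.reachable.trans h2.reachable

lemma dist_le_two {V : Type} {G : SimpleGraph V}
    (h : ∀ x y : V, G.Adj x y ∨ ∃ z, G.Adj x z ∧ G.Adj z y) (x y : V) :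
    (G.dist x y : ℝ) ≤ 2 := by
  have : G.dist x y ≤ 2 := by
    rcases h x y with h | ⟨z, h1, h2⟩
    · rw [SimpleGraph.dist_eq_one_iff_adj.mpr h]; norm_num
    · exact SimpleGraph.dist_le (Walk.cons h1 (Walk.cons h2 Walk.nil))
  exact_mod_cast this

/-- complete bipartite graph on `Fin n` with first part of size `a` -/
def evenG (n a : ℕ) : SimpleGraph (Fin n) where
  Adj i j := (i.1 < a ∧ a ≤ j.1) ∨ (a ≤ i.1 ∧ j.1 < a)
  symm := ⟨fun i j h => by omega⟩
  loopless := ⟨fun i h => by omega⟩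

lemma evenG_adj {n a : ℕ} {i j : Fin n} :
    (evenG n a).Adj i j ↔ (i.1 < a ∧ a ≤ j.1) ∨ (a ≤ i.1 ∧ j.1 < a) := Iff.rfl

lemma evenG_mem {n a : ℕ} (ha : 2 ≤ a) (hn : 2 * a ≤ n) :
    memGclass 4 (2 * a) (evenG n a) ∧ hypDelta (evenG n a) ≤ 1 := by
  have : Nonempty (Fin n) := ⟨⟨0, by omega⟩⟩
  have h2 : ∀ x y : Fin n, (evenG n a).Adj x y ∨ ∃ z, (evenG n a).Adj x z ∧ (evenG n a).Adj z y := by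
    intro x y
    by_cases hx : x.1 < a <;> by_cases hy : y.1 < a
    · exact Or.inr ⟨⟨a, by omega⟩, by simp only [evenG_adj]; omega, by simp only [evenG_adj]; omega⟩
    · left; simp only [evenG_adj]; omega
    · left; simp only [evenG_adj]; omega
    · exact Or.inr ⟨⟨0, by omega⟩, by simp only [evenG_adj]; omega, by simp only [evenG_adj]; omega⟩
  have hG := conn_of_two h2
  have hcyc : ∀ b, 2 ≤ b → b ≤ a →
      ∃ (x : Fin n) (w : (evenG n a).Walk x x), w.IsCycle ∧ w.length = 2 * b := by
    intro b hb hba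
    have hval : ∀ i, (if i % 2 = 0 then i / 2 else a + i / 2) % n < n :=
      fun i => Nat.mod_lt _ (by omega)
    have hv : ∀ i, i < 2 * b → (if i % 2 = 0 then i / 2 else a + i / 2) % n =
        if i % 2 = 0 then i / 2 else a + i / 2 := by
      intro i hi
      apply Nat.mod_eq_of_lt
      split_ifs <;> omega
    refine exists_cycle_of_seq (by omega)
      (fun i => ⟨(if i % 2 = 0 then i / 2 else a + i / 2) % n, hval i⟩) ?_ ?_ ?_
    · intro i hi j hj hij
      simp only [Fin.mk.injEq] at hij
      rw [hv i hi, hv j hj] at hij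
      split_ifs at hij <;> omega
    · intro i hi
      simp only [evenG_adj]
      rw [hv i (by omega), hv (i + 1) hi]
      split_ifs <;> omega
    · rw [evenG_adj]
      dsimp only [Fin.val_mk]
      rw [hv (2 * b - 1) (by omega), hv 0 (by omega)]
      split_ifs <;> omega
  refine ⟨⟨hG, ?_, ?_⟩, ?_⟩
  · apply girth_eq_four (hcyc 2 le_rfl ha)
    intro x y z h1 h2 h3
    simp only [evenG_adj] at h1 h2 h3
    omega
  · apply circ_eq (hcyc a ha le_rfl)
    intro x w hw
    have h := cycle_length_le hw (Finset.univ.filter (fun i : Fin n => i.1 < a)) ∅ (by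
      intro x y hxy
      simp only [evenG_adj] at hxy
      simp only [Finset.mem_filter, Finset.mem_univ, true_and]
      omega)
    have hc : (Finset.univ.filter (fun i : Fin n => i.1 < a)).card ≤ a := by
      calc _ ≤ (Finset.range a).card := by
            apply Finset.card_le_card_of_injOn (fun i => i.1)
            · intro i hi
              simp at hi
              simpa using hi
            · intro i _ j _ hij
              exact Fin.ext hij
        _ = a := Finset.card_range a
    simp only [Finset.card_empty] at h
    omega
  · apply hypDelta_le hG zero_le_one
    apply mgDist_le_of_pairs
    intro u v u' v' h h'
    have hd : ∀ x y : Fin n, (evenG n a).Adj x y → ((evenG n a).dist x y : ℝ) = 1 :=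
      fun x y => dist_of_adj
    simp only [evenG_adj] at h h'
    by_cases h1 : (evenG n a).Adj u u'
    · left
      rw [hd u u' h1, hd v v' (by simp only [evenG_adj] at h1 ⊢; omega)]; norm_num
    · right
      rw [hd u v' (by simp only [evenG_adj] at h1 ⊢; omega),
        hd v u' (by simp only [evenG_adj] at h1 ⊢; omega)]; norm_num

/-- adjacency in the five-cycle -/
abbrev R5 (x y : Fin 5) : Prop := x = y + 1 ∨ y = x + 1

/-- colouring defining the blow-up of the five-cycle -/
def col5 (k i : ℕ) : Fin 5 :=
  if i = 0 then 0 else if i = 1 then 1 else if i = 2 then 2 else if i < k + 3 then 3 else 4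

/-- blow-up of the five-cycle -/
def oddG (n k : ℕ) : SimpleGraph (Fin n) where
  Adj i j := R5 (col5 k i.1) (col5 k j.1)
  symm := ⟨fun i j h => Or.symm h⟩
  loopless := ⟨fun i h => by
    have : ∀ x : Fin 5, ¬ R5 x x := by decide
    exact this _ h⟩

lemma oddG_adj {n k : ℕ} {i j : Fin n} :
    (oddG n k).Adj i j ↔ R5 (col5 k i.1) (col5 k j.1) := Iff.rfl

lemma col5_3 {k i : ℕ} (h1 : 3 ≤ i) (h2 : i < k + 3) : col5 k i = 3 := by
  unfold col5
  rw [if_neg (by omega), if_neg (by omega), if_neg (by omega), if_pos h2]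

lemma col5_4 {k i : ℕ} (h2 : k + 3 ≤ i) : col5 k i = 4 := by
  unfold col5
  rw [if_neg (by omega), if_neg (by omega), if_neg (by omega), if_neg (by omega)]

lemma oddG_mem {n k : ℕ} (hk : 1 ≤ k) (hn : 2 * k + 3 ≤ n) (hn' : k + 5 ≤ n) :
    memGclass 4 (2 * k + 3) (oddG n k) ∧ hypDelta (oddG n k) ≤ 5 / 4 := by
  have : Nonempty (Fin n) := ⟨⟨0, by omega⟩⟩
  have hsurj : ∀ x : Fin 5, ∃ i : Fin n, col5 k i.1 = x := by
    intro x
    fin_cases x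
    · exact ⟨⟨0, by omega⟩, rfl⟩
    · exact ⟨⟨1, by omega⟩, rfl⟩
    · exact ⟨⟨2, by omega⟩, rfl⟩
    · exact ⟨⟨3, by omega⟩, col5_3 (by simp) (by simp; omega)⟩
    · exact ⟨⟨k + 3, by omega⟩, col5_4 (by simp)⟩
  have h2 : ∀ x y : Fin n, (oddG n k).Adj x y ∨ ∃ z, (oddG n k).Adj x z ∧ (oddG n k).Adj z y := by
    intro x y
    have hdec : ∀ x y : Fin 5, R5 x y ∨ ∃ z, R5 x z ∧ R5 z y := by decide
    rcases hdec (col5 k x.1) (col5 k y.1) with h | ⟨z, h1, h2⟩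
    · exact Or.inl h
    · obtain ⟨i, rfl⟩ := hsurj z
      exact Or.inr ⟨i, h1, h2⟩
  have hG := conn_of_two h2
  refine ⟨⟨hG, ?_, ?_⟩, ?_⟩
  · apply girth_eq_four
    · have a1 : (oddG n k).Adj ⟨0, by omega⟩ ⟨k + 3, by omega⟩ := by
        rw [oddG_adj]; rw [show col5 k (k+3) = 4 from col5_4 le_rfl]; exact Or.inl rfl
      have a2 : (oddG n k).Adj ⟨k + 3, by omega⟩ ⟨3, by omega⟩ := by
        rw [oddG_adj]
        rw [show col5 k (k+3) = 4 from col5_4 le_rfl,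
          show col5 k 3 = 3 from col5_3 le_rfl (by omega)]; exact Or.inl rfl
      have a3 : (oddG n k).Adj ⟨3, by omega⟩ ⟨k + 4, by omega⟩ := by
        rw [oddG_adj]
        rw [show col5 k (k+4) = 4 from col5_4 (by omega),
          show col5 k 3 = 3 from col5_3 le_rfl (by omega)]; exact Or.inr rfl
      have a4 : (oddG n k).Adj ⟨k + 4, by omega⟩ ⟨0, by omega⟩ := by
        rw [oddG_adj]; rw [show col5 k (k+4) = 4 from col5_4 (by omega)]; exact Or.inr rfl
      refine ⟨_, Walk.cons a1 (Walk.cons a2 (Walk.cons a3 (Walk.cons a4 Walk.nil))), ?_, by simp⟩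
      rw [Walk.isCycle_iff_isPath_tail_and_le_length]
      refine ⟨?_, by simp⟩
      simp [Walk.isPath_def]
      omega
    · intro x y z h1 h2 h3
      have hdec : ∀ x y z : Fin 5, R5 x y → R5 y z → R5 z x → False := by decide
      exact hdec _ _ _ h1 h2 h3
  · apply circ_eq
    · have hv : ∀ i, i < 2 * k + 3 →
          (if i < 3 then i else if i % 2 = 1 then 3 + (i - 3) / 2 else k + 3 + (i - 3) / 2) % n =
          if i < 3 then i else if i % 2 = 1 then 3 + (i - 3) / 2 else k + 3 + (i - 3) / 2 := by
        intro i hi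
        apply Nat.mod_eq_of_lt
        split_ifs <;> omega
      refine exists_cycle_of_seq (by omega)
        (fun i => ⟨(if i < 3 then i else if i % 2 = 1 then 3 + (i - 3) / 2
          else k + 3 + (i - 3) / 2) % n, Nat.mod_lt _ (by omega)⟩) ?_ ?_ ?_
      · intro i hi j hj hij
        simp only [Fin.mk.injEq] at hij
        rw [hv i hi, hv j hj] at hij
        split_ifs at hij <;> omega
      · intro i hi
        simp only [oddG_adj]
        rw [hv i (by omega), hv (i + 1) hi]
        rcases (by omega : i = 0 ∨ i = 1 ∨ i = 2 ∨ 3 ≤ i) with rfl | rfl | rfl | h3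
        · exact Or.inr rfl
        · exact Or.inr rfl
        · rw [if_pos (show 2 < 3 by norm_num), if_neg (show ¬ 2 + 1 < 3 by norm_num),
            if_pos (show (2 + 1) % 2 = 1 by norm_num),
            col5_3 (i := 3 + _) (by omega) (by omega)]
          exact Or.inr rfl
        · rw [if_neg (show ¬ i < 3 by omega), if_neg (show ¬ i + 1 < 3 by omega)]
          by_cases hp : i % 2 = 1
          · rw [if_pos hp, if_neg (show ¬ (i + 1) % 2 = 1 by omega),
              col5_3 (i := 3 + _) (by omega) (by omega), col5_4 (by omega)]
            exact Or.inr rfl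
          · rw [if_neg hp, if_pos (show (i + 1) % 2 = 1 by omega), col5_3 (i := 3 + _) (by omega) (by omega),
              col5_4 (by omega)]
            exact Or.inl rfl
      · simp only [oddG_adj]
        rw [hv _ (by omega), hv 0 (by omega), if_neg (by omega), if_neg (by omega),
          col5_4 (by omega)]
        exact Or.inr rfl
    · intro x w hw
      have h := cycle_length_le hw
        (Finset.univ.filter (fun i : Fin n => col5 k i.1 = 0 ∨ col5 k i.1 = 3))
        {s((⟨1, by omega⟩ : Fin n), (⟨2, by omega⟩ : Fin n))} (by
        intro x y hxy
        have hdec : ∀ x y : Fin 5, R5 x y → (x = 0 ∨ x = 3) ∨ (y = 0 ∨ y = 3) ∨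
          (x = 1 ∧ y = 2) ∨ (x = 2 ∧ y = 1) := by decide
        have e1 : ∀ x : Fin n, col5 k x.1 = 1 → x = ⟨1, by omega⟩ := by
          intro x hx
          unfold col5 at hx
          apply Fin.ext
          split_ifs at hx <;> simp_all
        have e2 : ∀ x : Fin n, col5 k x.1 = 2 → x = ⟨2, by omega⟩ := by
          intro x hx
          unfold col5 at hx
          apply Fin.ext
          split_ifs at hx <;> simp_all
        simp only [Finset.mem_filter, Finset.mem_univ, true_and, Finset.mem_singleton]
        rcases hdec _ _ hxy with h | h | ⟨h1, h2⟩ | ⟨h1, h2⟩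
        · exact Or.inl h
        · exact Or.inr (Or.inl h)
        · right; right; rw [e1 x h1, e2 y h2]
        · right; right; rw [e2 x h1, e1 y h2]; exact Sym2.eq_swap)
      have hc : (Finset.univ.filter
          (fun i : Fin n => col5 k i.1 = 0 ∨ col5 k i.1 = 3)).card ≤ k + 1 := by
        calc _ ≤ (insert 0 (Finset.Ico 3 (k + 3))).card := by
              apply Finset.card_le_card_of_injOn (fun i => i.1)
              · intro i hi
                simp only [Finset.coe_filter, Finset.mem_univ, true_and, Set.mem_ofPred_eq] at hi
                simp only [Finset.mem_coe, Finset.mem_insert, Finset.mem_Ico]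
                unfold col5 at hi
                split_ifs at hi <;> first | omega | simp_all
              · intro i _ j _ hij
                exact Fin.ext hij
          _ ≤ (Finset.Ico 3 (k + 3)).card + 1 := Finset.card_insert_le _ _
          _ = k + 1 := by simp
      simp only [Finset.card_singleton] at h
      omega
  · apply hypDelta_le hG (by norm_num)
    apply mgDist_le_of_pairs
    intro u v u' v' h h'
    have hd : ∀ x y : Fin n, (oddG n k).Adj x y → ((oddG n k).dist x y : ℝ) = 1 :=
      fun x y => dist_of_adj
    have hd2 := dist_le_two h2
    have hdec : ∀ x y x' y' : Fin 5, R5 x y → R5 x' y' →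
      R5 x x' ∨ R5 y y' ∨ R5 x y' ∨ R5 y x' := by decide
    rcases hdec _ _ _ _ h h' with h | h | h | h
    · left; rw [hd u u' h]; linarith [hd2 v v']
    · left; rw [hd v v' h]; linarith [hd2 u u']
    · right; rw [hd u v' h]; linarith [hd2 v u']
    · right; rw [hd v u' h]; linarith [hd2 u v']

lemma L_le_card {V : Type} [Fintype V] {G : SimpleGraph V} (v : ℤ → V) (L : ℕ)
    (H : ∀ i j : ℤ, ∃ k : ℤ, |i - j - k * L| ≤ (G.dist (v i) (v j) : ℤ)) :
    Function.Injective (fun i : Fin L => v i.1) := by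
  intro i j hij
  simp only at hij
  obtain ⟨k, hk⟩ := H i.1 j.1
  rw [hij] at hk
  simp only [SimpleGraph.dist_self, Nat.cast_zero] at hk
  have h0 := abs_eq_zero.mp (le_antisymm hk (abs_nonneg _))
  have hi := i.2
  have hj := j.2
  have hk0 : k = 0 := by
    rcases lt_trichotomy k 0 with h | h | h
    · have : k * (L:ℤ) ≤ -1 * L := by
        apply mul_le_mul_of_nonneg_right (by omega) (by omega)
      omega
    · exact h
    · have : 1 * (L:ℤ) ≤ k * L := by
        apply mul_le_mul_of_nonneg_right (by omega) (by omega)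
      omega
  rw [hk0] at h0
  apply Fin.ext
  omega

lemma not_mem_five (G : SimpleGraph (Fin 5)) : ¬ memGclass 4 5 G := by
  rintro ⟨hG, hg, hc⟩
  obtain ⟨a, w, -, hw⟩ := exists_cycle_of_circ (by norm_num) hc
  obtain ⟨L, v, hL, -, -, H⟩ := exists_iso_odd hG hg ⟨a, w, by rw [hw]; decide⟩
  have hinj := L_le_card v L H
  have hcard := Fintype.card_le_of_injective _ hinj
  simp only [Fintype.card_fin] at hcard
  obtain rfl : L = 5 := by omega
  have hsurj := Finite.injective_iff_surjective.mp hinj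
  obtain ⟨u, hadj, hper, hne, -⟩ := exists_iso_four hG hg
  have step : ∀ i j : Fin 5, G.Adj (v i.1) (v j.1) →
      ∃ k : ℤ, |(i.1 : ℤ) - j.1 - k * (5 : ℕ)| ≤ 1 := by
    intro i j hij
    obtain ⟨k, hk⟩ := H i.1 j.1
    rw [SimpleGraph.dist_eq_one_iff_adj.mpr hij] at hk
    exact ⟨k, hk⟩
  obtain ⟨a0, h0⟩ := hsurj (u 0)
  obtain ⟨a1, h1⟩ := hsurj (u 1)
  obtain ⟨a2, h2⟩ := hsurj (u 2)
  obtain ⟨a3, h3⟩ := hsurj (u 3)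
  have b0 := hadj 0
  have b1 := hadj 1
  have b2 := hadj 2
  have b3 := hadj 3
  have n0 := hne 0
  have n1 := hne 1
  have p0 := hper 0
  norm_num at b0 b1 b2 b3 n0 n1 p0
  rw [p0] at b3
  rw [← h0, ← h1] at b0
  rw [← h1, ← h2] at b1
  rw [← h2, ← h3] at b2
  rw [← h3, ← h0] at b3
  rw [← h0, ← h2] at n0
  rw [← h1, ← h3] at n1
  have e0 : a0 ≠ a1 := fun h => b0.ne (by rw [h])
  have e1 : a1 ≠ a2 := fun h => b1.ne (by rw [h])
  have e2 : a2 ≠ a3 := fun h => b2.ne (by rw [h])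
  have e3 : a3 ≠ a0 := fun h => b3.ne (by rw [h])
  have e4 : a0 ≠ a2 := fun h => n0 (by rw [h])
  have e5 : a1 ≠ a3 := fun h => n1 (by rw [h])
  obtain ⟨k0, s0⟩ := step _ _ b0
  obtain ⟨k1, s1⟩ := step _ _ b1
  obtain ⟨k2, s2⟩ := step _ _ b2
  obtain ⟨k3, s3⟩ := step _ _ b3
  rw [abs_le] at s0 s1 s2 s3
  have r : ∀ i j : Fin 5, i ≠ j → ∀ k : ℤ, (-1 ≤ (i.1 : ℤ) - j.1 - k * (5 : ℕ) ∧
      (i.1 : ℤ) - j.1 - k * (5 : ℕ) ≤ 1) → R5 i j := by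
    intro i j hij k hk
    have hi := i.2
    have hj := j.2
    have hne' : i.1 ≠ j.1 := fun h => hij (Fin.ext h)
    simp only [R5, Fin.ext_iff, Fin.val_add]
    simp only [Fin.val_one]
    omega
  have hdec : ∀ a0 a1 a2 a3 : Fin 5, R5 a0 a1 → R5 a1 a2 → R5 a2 a3 → R5 a3 a0 →
    a0 ≠ a2 → a1 ≠ a3 → False := by decide
  exact hdec _ _ _ _ (r _ _ e0 _ s0) (r _ _ e1 _ s1) (r _ _ e2 _ s2) (r _ _ e3 _ s3) e4 e5

end constructions

/-- Theorem (calculo2): For every v-admissible triplet `(4,c,n)`, `A(4,c,n) = 1`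
if `c` is even, and `A(4,c,n) = 5/4` if `c` is odd. -/
theorem Agcn_four (c n : ℕ) (h4 : 4 ≤ c) (hcn : c ≤ n)
    (hadm : ∃ G : SimpleGraph (Fin n), memGclass 4 c G) :
    (Even c → Agcn 4 c n = 1) ∧ (Odd c → Agcn 4 c n = 5 / 4) := by
  have conclude : ∀ x : ℝ, (∀ G : SimpleGraph (Fin n), memGclass 4 c G → x ≤ hypDelta G) →
      (∃ G : SimpleGraph (Fin n), memGclass 4 c G ∧ hypDelta G ≤ x) → Agcn 4 c n = x := by
    rintro x hlow ⟨G, hG, hGx⟩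
    apply le_antisymm
    · refine le_trans (csInf_le ⟨x, ?_⟩ ⟨G, hG, rfl⟩) hGx
      rintro d ⟨G', hG', rfl⟩
      exact hlow G' hG'
    · refine le_csInf ⟨_, G, hG, rfl⟩ ?_
      rintro d ⟨G', hG', rfl⟩
      exact hlow G' hG'
  constructor
  · rintro ⟨a, rfl⟩
    rw [← two_mul] at *
    apply conclude
    · rintro G ⟨hG, hg, -⟩
      obtain ⟨v, hv, hper, -, H⟩ := exists_iso_four hG hg
      have := le_hypDelta_of_cycle hG v hv 4 (by norm_num) hper H
      norm_num at this
      exact this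
    · exact ⟨_, evenG_mem (by omega) hcn⟩
  · rintro hodd
    apply conclude
    · rintro G ⟨hG, hg, hc⟩
      obtain ⟨a, w, -, hw⟩ := exists_cycle_of_circ (by omega) hc
      obtain ⟨L, v, hL, hv, hper, H⟩ := exists_iso_odd hG hg ⟨a, w, by rw [hw]; exact hodd⟩
      have h1 := le_hypDelta_of_cycle hG v hv L (by omega) hper H
      have h2 : (5 : ℝ) ≤ L := by exact_mod_cast hL
      linarith
    · obtain ⟨m, hm⟩ := hodd
      obtain ⟨k, rfl⟩ : ∃ k, m = k + 1 := ⟨m - 1, by omega⟩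
      have hc : c = 2 * k + 3 := by omega
      subst hc
      refine ⟨_, oddG_mem (by omega) hcn ?_⟩
      by_contra hlt
      have hk : k = 1 := by omega
      have hn5 : n = 5 := by omega
      subst hk hn5
      obtain ⟨G, hG⟩ := hadm
      exact not_mem_five G hG
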